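/- arXiv:2201.02914 — 8 statements merged into one kernel-verified Lean document; each statement's English description precedes it below -/
import Mathlib

section
/- Let w ∈ ℝ^n with w ≥ 0, let s ≥ 1 and 1 ≤ t ≤ m, and suppose that for every X ⊆ {1,…,n} with |X| ≤ s there exists T_X ⊆ {1,…,m} with |T_X| ≤ t such that every z ∈ {0,1}^n with z_i = 0 for all i ∉ X and (A z)_j ≤ b_j for all j ∈ T_X in fact satisfies A z ≤ b. Let OPT = max{w^T z : z ∈ {0,1}^n, A z ≤ b}. Then for every x ∈ P^t one has w^T x ≤ ⌈n/s⌉ · OPT. (This is the O(k/t) integrality-gap upper bound for the knapsack intersection hierarchy, applied with s = ⌊t/4⌋ for ANF-Tree instances.) -/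
open Finset

/-- `K_I(S)`: the integer hull of the intersection of the knapsack constraints indexed by `S`. -/
def KIhull {m n : ℕ} (A : Matrix (Fin m) (Fin n) ℝ) (b : Fin m → ℝ) (S : Finset (Fin m)) :
    Set (Fin n → ℝ) :=
  convexHull ℝ {z | (∀ i, z i = 0 ∨ z i = 1) ∧ ∀ j ∈ S, A.mulVec z j ≤ b j}

/-- `P^t`: the level `t` of the knapsack intersection hierarchy. -/
def Pt {m n : ℕ} (A : Matrix (Fin m) (Fin n) ℝ) (b : Fin m → ℝ) (t : ℕ) : Set (Fin n → ℝ) :=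
  ⋂ S ∈ {S : Finset (Fin m) | S.card = t}, KIhull A b S

/-- The part of the objective supported on `X` is at most `OPT` on a relaxation `K_I(S)` whose
constraints imply all the others for 0/1 vectors supported on `X`. -/
theorem sum_le_of_mem_KIhull {m n : ℕ} {A : Matrix (Fin m) (Fin n) ℝ} (hA : ∀ i j, 0 ≤ A i j)
    {b : Fin m → ℝ} {w : Fin n → ℝ} {X : Finset (Fin n)} {S : Finset (Fin m)}
    (hX : ∀ z : Fin n → ℝ, (∀ i, z i = 0 ∨ z i = 1) → (∀ i ∉ X, z i = 0) →
      (∀ j ∈ S, A.mulVec z j ≤ b j) → ∀ j, A.mulVec z j ≤ b j)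
    {OPT : ℝ} (hOPT : ∀ z : Fin n → ℝ, (∀ i, z i = 0 ∨ z i = 1) →
      (∀ j, A.mulVec z j ≤ b j) → ∑ i, w i * z i ≤ OPT)
    {x : Fin n → ℝ} (hx : x ∈ KIhull A b S) : ∑ i ∈ X, w i * x i ≤ OPT := by
  have hlin : IsLinearMap ℝ fun y : Fin n → ℝ => ∑ i ∈ X, w i * y i :=
    { map_add := fun y z => by simp [mul_add, Finset.sum_add_distrib]
      map_smul := fun c y => by simp [Finset.mul_sum, mul_left_comm] }
  refine convexHull_min (t := {y | ∑ i ∈ X, w i * y i ≤ OPT}) ?_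
    (convex_halfSpace_le hlin OPT) hx
  rintro z ⟨hz, hzS⟩
  let y : Fin n → ℝ := fun i => if i ∈ X then z i else 0
  have hy : ∀ i, y i = 0 ∨ y i = 1 := fun i => by
    by_cases hi : i ∈ X <;> simp [y, hi, hz i]
  have hyz : ∀ i, y i ≤ z i := fun i => by
    by_cases hi : i ∈ X
    · simp [y, hi]
    · rcases hz i with h | h <;> simp [y, hi, h]
  have hsum := hOPT y hy <| hX y hy (fun i hi => by simp [y, hi]) fun j hj =>
    (dotProduct_le_dotProduct_of_nonneg_left hyz (hA j)).trans (hzS j hj)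
  simpa [y] using hsum

/-- The blocks `{i | i / s = k}` of `s` consecutive indices have at most `s` elements. -/
theorem card_filter_div_eq_le {n s : ℕ} (hs : 1 ≤ s) (k : ℕ) :
    (univ.filter fun i : Fin n => (i : ℕ) / s = k).card ≤ s := by
  calc (univ.filter fun i : Fin n => (i : ℕ) / s = k).card
      ≤ (Finset.Ico (k * s) (k * s + s)).card := by
        refine Finset.card_le_card_of_injOn (fun i => (i : ℕ)) ?_ Fin.val_injective.injOn
        intro i hi
        have h : (i : ℕ) / s = k := by simpa using hi
        have hmod := Nat.mod_lt (i : ℕ) hs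
        have hdiv := Nat.div_add_mod' (i : ℕ) s
        rw [h] at hdiv
        simp only [Finset.coe_Ico, Set.mem_Ico]
        omega
    _ = s := by simp

theorem gap_upper_bound (m n : ℕ) (hm : 1 ≤ m) (hn : 1 ≤ n)
    (A : Matrix (Fin m) (Fin n) ℝ) (hA : ∀ i j, 0 ≤ A i j)
    (b : Fin m → ℝ) (hb : ∀ j, 0 ≤ b j)
    (w : Fin n → ℝ) (hw : ∀ i, 0 ≤ w i)
    (s t : ℕ) (hs : 1 ≤ s) (ht1 : 1 ≤ t) (htm : t ≤ m)
    (hlocal : ∀ X : Finset (Fin n), X.card ≤ s →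
      ∃ T : Finset (Fin m), T.card ≤ t ∧
        ∀ z : Fin n → ℝ, (∀ i, z i = 0 ∨ z i = 1) → (∀ i ∉ X, z i = 0) →
          (∀ j ∈ T, A.mulVec z j ≤ b j) → ∀ j, A.mulVec z j ≤ b j)
    (OPT : ℝ)
    (hOPT : IsGreatest {p : ℝ | ∃ z : Fin n → ℝ, (∀ i, z i = 0 ∨ z i = 1) ∧
      (∀ j, A.mulVec z j ≤ b j) ∧ p = ∑ i, w i * z i} OPT) :
    ∀ x ∈ Pt A b t, ∑ i, w i * x i ≤ (⌈(n : ℝ) / (s : ℝ)⌉₊ : ℝ) * OPT := by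
  intro x hx
  have hblock : ∀ k, ∑ i ∈ univ.filter (fun i : Fin n => (i : ℕ) / s = k), w i * x i ≤ OPT := by
    intro k
    obtain ⟨T, hT, hTX⟩ := hlocal _ (card_filter_div_eq_le hs k)
    obtain ⟨S, hTS, hS⟩ := Finset.exists_superset_card_eq hT (by simpa using htm)
    refine sum_le_of_mem_KIhull hA
      (fun z hz hzX hzS => hTX z hz hzX fun j hj => hzS j (hTS hj))
      (fun z hz hAz => hOPT.2 ⟨z, hz, hAz, rfl⟩) (Set.mem_iInter₂.1 hx S hS)
  have hmaps : ∀ i ∈ (univ : Finset (Fin n)),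
      (i : ℕ) / s ∈ Finset.range ⌈(n : ℝ) / (s : ℝ)⌉₊ := by
    intro i _
    rw [Finset.mem_range, Nat.lt_ceil]
    calc (((i : ℕ) / s : ℕ) : ℝ) ≤ (i : ℕ) / (s : ℝ) := Nat.cast_div_le
      _ < (n : ℝ) / s := by
        have : (0 : ℝ) < s := by exact_mod_cast hs
        gcongr
        exact i.isLt
  rw [← Finset.sum_fiberwise_of_maps_to hmaps]
  simpa using Finset.sum_le_card_nsmul (Finset.range ⌈(n : ℝ) / (s : ℝ)⌉₊) _ OPT
    fun k _ => hblock k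
end

section
/- For every t with 1 ≤ t ≤ k and every I ⊆ {1,…,k} with |I| = t, the constant vector (1/(t+1), …, 1/(t+1)) ∈ ℝ^k lies in K_I(I); consequently the constant vector 1/(t+1) lies in P^t for the staircase instance S^k. (Since the all-ones profit of this vector is k/(t+1), this shows the integrality gap of P^t is Ω(k/t) on staircase instances.) -/
open Finset

/-- `z` satisfies the staircase constraint `j` of the instance `S^k`
(constraint `j`, for `j = 1, …, k`, reads `∑_{i=j}^k 2^{k-i} x_i ≤ 2^{k-j}`;
here indices are `0`-based, so index `j : Fin k` encodes constraint `j+1`). -/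
def stairConstr (k : ℕ) (j : Fin k) (z : Fin k → ℝ) : Prop :=
  ∑ i ∈ Finset.univ.filter (fun i : Fin k => j ≤ i), (2 : ℝ) ^ (k - 1 - i.val) * z i ≤
    (2 : ℝ) ^ (k - 1 - j.val)

/-- `K_I(I)` for the staircase instance `S^k`. -/
def stairKI (k : ℕ) (I : Finset (Fin k)) : Set (Fin k → ℝ) :=
  convexHull ℝ {z | (∀ i, z i = 0 ∨ z i = 1) ∧ ∀ j ∈ I, stairConstr k j z}

/-- `P^t` for the staircase instance `S^k`. -/
def stairPt (k t : ℕ) : Set (Fin k → ℝ) :=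
  ⋂ I ∈ {I : Finset (Fin k) | I.card = t}, stairKI k I

/-- The coefficients strictly after `j` sum to at most the capacity of constraint `j`. -/
theorem sum_two_pow_gt_le (k : ℕ) (j : Fin k) :
    ∑ i ∈ Finset.univ.filter (fun i : Fin k => j < i), (2 : ℝ) ^ (k - 1 - i.val) ≤
      (2 : ℝ) ^ (k - 1 - j.val) := by
  have hinj : Set.InjOn (fun i : Fin k => k - 1 - i.val)
      (Finset.univ.filter (fun i : Fin k => j < i) : Finset (Fin k)) := by
    intro a _ b _ hab
    have ha := a.isLt
    have hb := b.isLt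
    ext
    dsimp only at hab
    omega
  have h : ∑ i ∈ Finset.univ.filter (fun i : Fin k => j < i), 2 ^ (k - 1 - i.val) <
      2 ^ (k - 1 - j.val) := by
    rw [← Finset.sum_image (f := fun n => 2 ^ n) hinj]
    refine Nat.geomSum_lt le_rfl fun n hn => ?_
    simp only [Finset.mem_image, Finset.mem_filter, Finset.mem_univ, true_and,
      Fin.lt_def] at hn
    obtain ⟨i, hi, rfl⟩ := hn
    have := i.isLt
    omega
  exact_mod_cast h.le

/-- The indicator of a single coordinate satisfies every staircase constraint. -/
theorem stairConstr_single (k : ℕ) (a j : Fin k) :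
    stairConstr k j (fun i => if i = a then 1 else 0) := by
  simp only [stairConstr, mul_ite, mul_one, mul_zero, Finset.sum_ite_eq', Finset.mem_filter,
    Finset.mem_univ, true_and]
  split_ifs with h
  · rw [Fin.le_def] at h
    exact pow_le_pow_right₀ one_le_two (by omega)
  · positivity

/-- The indicator of the complement of `I` satisfies every staircase constraint in `I`. -/
theorem stairConstr_compl (k : ℕ) (I : Finset (Fin k)) (j : Fin k) (hj : j ∈ I) :
    stairConstr k j (fun i => if i ∈ I then 0 else 1) := by
  refine le_trans ?_ (sum_two_pow_gt_le k j)
  simp only [Finset.sum_filter]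
  refine Finset.sum_le_sum fun i _ => ?_
  rcases lt_trichotomy j i with h | rfl | h
  · rw [if_pos h.le, if_pos h]
    split_ifs <;> simp
  · simp [hj]
  · simp [h.not_ge, h.not_gt]

/-- The constant vector `1 / (#I + 1)` is the average of the indicators of the singletons in `I`
and of the complement of `I`. -/
theorem const_mem_stairKI (k : ℕ) (I : Finset (Fin k)) :
    (fun _ : Fin k => (1 / ((I.card : ℝ) + 1))) ∈ stairKI k I := by
  have hpos : (0 : ℝ) < (I.card : ℝ) + 1 := by positivity
  let p : Option (Fin k) → Fin k → ℝ := fun o =>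
    o.elim (fun i => if i ∈ I then 0 else 1) (fun a i => if i = a then 1 else 0)
  have hmem : ∑ o ∈ Finset.insertNone I, (1 / ((I.card : ℝ) + 1)) • p o ∈ stairKI k I := by
    refine (convex_convexHull ℝ _).sum_mem (fun _ _ => by positivity) ?_ fun o _ => ?_
    · simp only [Finset.sum_const, Finset.card_insertNone, nsmul_eq_mul]
      push_cast
      field_simp
    · refine subset_convexHull ℝ _ ?_
      cases o with
      | none => exact ⟨fun i => by by_cases h : i ∈ I <;> simp [p, h],
          fun j hj => stairConstr_compl k I j hj⟩
      | some a => exact ⟨fun i => by by_cases h : i = a <;> simp [p, h],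
          fun j _ => stairConstr_single k a j⟩
  convert hmem using 1
  ext i
  rw [← Finset.smul_sum]
  by_cases h : i ∈ I <;> simp [p, Finset.sum_insertNone, Finset.sum_apply, h]

theorem staircase_lower_bound (k t : ℕ) (hk : 1 ≤ k) (ht1 : 1 ≤ t) (htk : t ≤ k) :
    (∀ I : Finset (Fin k), I.card = t →
        (fun _ : Fin k => (1 / ((t : ℝ) + 1))) ∈ stairKI k I) ∧
    (fun _ : Fin k => (1 / ((t : ℝ) + 1))) ∈ stairPt k t := by
  have h : ∀ I : Finset (Fin k), I.card = t →
      (fun _ : Fin k => (1 / ((t : ℝ) + 1))) ∈ stairKI k I := by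
    rintro I rfl
    exact const_mem_stairKI k I
  exact ⟨h, Set.mem_iInter₂.2 h⟩
end

section
/- For every vertex v of T^h_FG in level ℓ (1 ≤ ℓ ≤ h), the set of all requests strictly below v is routable on e_v: the total demand of all strict descendants of v is at most the capacity of e_v, i.e. ∑_{ℓ'=ℓ+1}^{h} 2^{(h−1)(ℓ'−ℓ)} · (2^{h(h−ℓ'+1)} − 2^{h(h−ℓ')}) ≤ 2^{h(h−ℓ+1)}. -/
open Finset

/-- The vertex/request set of the Friggstad–Gao instance `T^h_FG`: sequences over
`{1,…,2^{h-1}}` of length at most `h-1`, encoded as a pair of a length `< h`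
together with a tuple of that length. -/
abbrev FGV (h : ℕ) : Type := Σ k : Fin h, (Fin (k : ℕ) → Fin (2 ^ (h - 1)))

/-- The level of a vertex: its length plus one. -/
def FGlevel {h : ℕ} (v : FGV h) : ℕ := (v.1 : ℕ) + 1

/-- The prefix order `v ⪯ w` on sequences. -/
def FGprefix {h : ℕ} (v w : FGV h) : Prop :=
  (v.1 : ℕ) ≤ (w.1 : ℕ) ∧
    ∀ i : Fin (v.1 : ℕ), ∀ j : Fin (w.1 : ℕ), (i : ℕ) = (j : ℕ) → w.2 j = v.2 i

instance {h : ℕ} (v w : FGV h) : Decidable (FGprefix v w) := by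
  unfold FGprefix; infer_instance

/-- The demand of a level-`ℓ` request: `2^{h(h-ℓ+1)} - 2^{h(h-ℓ)}`. -/
def FGdemand {h : ℕ} (v : FGV h) : ℝ :=
  2 ^ (h * (h - FGlevel v + 1)) - 2 ^ (h * (h - FGlevel v))

/-- The capacity of the parent edge `e_v` of a level-`ℓ` vertex: `2^{h(h-ℓ+1)}`. -/
def FGcap {h : ℕ} (v : FGV h) : ℝ := 2 ^ (h * (h - FGlevel v + 1))

/-- The profit of a level-`ℓ` request: `2^{-(h-1)(ℓ-1)}`. -/
noncomputable def FGprofit {h : ℕ} (v : FGV h) : ℝ :=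
  (2 : ℝ) ^ (-(((h - 1) * (FGlevel v - 1) : ℕ) : ℤ))

/-- `X` is routable on the edge `e_v`. -/
def RoutableOn {h : ℕ} (X : Finset (FGV h)) (v : FGV h) : Prop :=
  ∑ w ∈ X.filter (fun w => FGprefix v w), FGdemand w ≤ FGcap v

/-- `X` is `S`-routable. -/
def SRoutable {h : ℕ} (X S : Finset (FGV h)) : Prop :=
  ∀ v ∈ S, RoutableOn X v

/-- `X` is routable. -/
def Routable {h : ℕ} (X : Finset (FGV h)) : Prop :=
  ∀ v : FGV h, RoutableOn X v

/-- `K_I(S)` for the Friggstad–Gao instance: the convex hull of indicator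
vectors of `S`-routable sets. -/
def FGKI {h : ℕ} (S : Finset (FGV h)) : Set (FGV h → ℝ) :=
  convexHull ℝ
    {x | ∃ X : Finset (FGV h), SRoutable X S ∧ x = fun w => if w ∈ X then (1 : ℝ) else 0}

/-- `P^t` for the Friggstad–Gao instance. -/
def FGP (h t : ℕ) : Set (FGV h → ℝ) :=
  ⋂ S ∈ {S : Finset (FGV h) | S.card = t}, FGKI S

theorem sum_Icc_half_pow_sub (a n : ℕ) :
    ∑ k ∈ Finset.Icc (a + 1) (a + n), ((1 : ℝ) / 2) ^ (k - a) = 1 - (1 / 2) ^ n := by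
  induction n with
  | zero => simp
  | succ n ih =>
    rw [← add_assoc, Finset.sum_Icc_succ_top (by omega), ih,
      show a + n + 1 - a = n + 1 by omega]
    ring

theorem sum_levels_below_le_cap (h l : ℕ) (hh : 1 ≤ h) (hl : l ≤ h) :
    ∑ k ∈ Finset.Icc (l + 1) h,
        (2 : ℝ) ^ ((h - 1) * (k - l)) *
          ((2 : ℝ) ^ (h * (h - k + 1)) - (2 : ℝ) ^ (h * (h - k))) ≤
      (2 : ℝ) ^ (h * (h - l + 1)) := by
  obtain ⟨n, rfl⟩ := Nat.exists_eq_add_of_le hl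
  generalize hH : l + n = h at *
  calc _ ≤ ∑ k ∈ Finset.Icc (l + 1) h,
        (2 : ℝ) ^ (h * (h - l + 1)) * (1 / 2) ^ (k - l) := by
        refine Finset.sum_le_sum fun k hk => ?_
        rw [Finset.mem_Icc] at hk
        obtain ⟨j, rfl⟩ := Nat.exists_eq_add_of_le (show l ≤ k by omega)
        obtain ⟨m, hm⟩ := Nat.exists_eq_add_of_le hk.2
        obtain ⟨p, rfl⟩ := Nat.exists_eq_add_of_le' hh
        rw [show p + 1 - (l + j) = m by omega, show p + 1 - l = m + j by omega,
          Nat.add_sub_cancel, Nat.add_sub_cancel_left]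
        calc _ ≤ (2 : ℝ) ^ (p * j) * 2 ^ ((p + 1) * (m + 1)) := by
              gcongr
              exact sub_le_self _ (by positivity)
          _ = _ := by
              rw [one_div, inv_pow, eq_mul_inv_iff_mul_eq₀ (by positivity), ← pow_add, ← pow_add]
              congr 1
              ring
    _ = (2 : ℝ) ^ (h * (h - l + 1)) * (1 - (1 / 2) ^ n) := by
        rw [← Finset.mul_sum, ← sum_Icc_half_pow_sub l n, hH]
    _ ≤ _ := mul_le_of_le_one_right (by positivity) (sub_le_self _ (by positivity))

theorem FGlevel_lt_of_FGprefix_of_ne {h : ℕ} {v w : FGV h} (hp : FGprefix v w) (hne : w ≠ v) :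
    FGlevel v < FGlevel w := by
  obtain ⟨hle, hv⟩ := hp
  refine Nat.succ_lt_succ (hle.lt_of_ne fun heq => hne ?_)
  obtain ⟨k, f⟩ := v
  obtain ⟨k', g⟩ := w
  obtain rfl : k = k' := Fin.ext heq
  exact congrArg (Sigma.mk k) (funext fun i => hv i i rfl)

theorem card_filter_FGprefix_level_le {h : ℕ} (v : FGV h) (k : ℕ) :
    (Finset.univ.filter fun w : FGV h => FGprefix v w ∧ FGlevel w = k).card ≤
      2 ^ ((h - 1) * (k - FGlevel v)) := by
  by_cases hk : k - 1 < h
  swap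
  · rw [Finset.card_eq_zero.mpr]
    · positivity
    · refine Finset.filter_eq_empty_iff.mpr fun w _ hw => hk ?_
      rw [← hw.2]
      exact w.1.2
  have hcard : Fintype.card (Fin (k - FGlevel v) → Fin (2 ^ (h - 1))) =
      2 ^ ((h - 1) * (k - FGlevel v)) := by
    rw [Fintype.card_fun, Fintype.card_fin, Fintype.card_fin, pow_mul]
  rw [← hcard, ← Finset.card_univ]
  refine Finset.card_le_card_of_injOn
    (fun w i => if hi : FGlevel v - 1 + i < (w.1 : ℕ) then w.2 ⟨_, hi⟩ else ⟨0, by positivity⟩)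
    (fun _ _ => Finset.mem_coe.mpr (Finset.mem_univ _)) ?_
  rintro ⟨a, f⟩ hf ⟨b, g⟩ hg hfg
  rw [Finset.mem_coe, Finset.mem_filter] at hf hg
  simp only [Finset.mem_univ, true_and, FGlevel, FGprefix] at hf hg
  obtain rfl : a = b := Fin.ext (by omega)
  refine congrArg (Sigma.mk a) (funext fun j => ?_)
  by_cases hj : (j : ℕ) < v.1
  · rw [hf.1.2 ⟨j, hj⟩ j rfl, hg.1.2 ⟨j, hj⟩ j rfl]
  · have hja := j.2
    have := congrFun hfg ⟨j - v.1, by simp only [FGlevel]; omega⟩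
    have hj' : (v.1 : ℕ) + (j - v.1) = j := by omega
    simpa [FGlevel, hj'] using this

theorem routableOn_strict_descendants {h : ℕ} (v : FGV h) :
    RoutableOn (Finset.univ.filter (fun w => FGprefix v w ∧ w ≠ v)) v := by
  have hh : 1 ≤ h := Nat.one_le_of_lt v.1.2
  refine le_trans ?_ (sum_levels_below_le_cap h (FGlevel v) hh v.1.2)
  rw [← Finset.sum_fiberwise_of_maps_to (g := FGlevel) (t := Finset.Icc (FGlevel v + 1) h)]
  · refine Finset.sum_le_sum fun k _ => ?_
    have hd : (0 : ℝ) ≤ 2 ^ (h * (h - k + 1)) - 2 ^ (h * (h - k)) :=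
      sub_nonneg.mpr (pow_le_pow_right₀ one_le_two (Nat.mul_le_mul_left h (Nat.le_succ _)))
    rw [Finset.sum_congr rfl (g := fun _ => (2 : ℝ) ^ (h * (h - k + 1)) - 2 ^ (h * (h - k)))
      (fun w hw => by rw [FGdemand, (Finset.mem_filter.mp hw).2]), Finset.sum_const, nsmul_eq_mul]
    refine mul_le_mul_of_nonneg_right ?_ hd
    refine le_trans (Nat.cast_le.mpr (Finset.card_le_card ?_))
      ((Nat.cast_le.mpr (card_filter_FGprefix_level_le v k)).trans_eq (by push_cast; rfl))
    intro w hw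
    simp only [Finset.mem_filter] at hw ⊢
    exact ⟨Finset.mem_univ w, hw.1.2, hw.2⟩
  · intro w hw
    simp only [Finset.mem_filter] at hw
    exact Finset.mem_Icc.mpr ⟨FGlevel_lt_of_FGprefix_of_ne hw.2 hw.1.2.2, w.1.2⟩

theorem subtree_routable (h : ℕ) (hh : 2 ≤ h) :
    (∀ v : FGV h,
        RoutableOn (Finset.univ.filter (fun w => FGprefix v w ∧ w ≠ v)) v) ∧
    (∀ ℓ : ℕ, 1 ≤ ℓ → ℓ ≤ h →
      ∑ ℓ' ∈ Finset.Icc (ℓ + 1) h,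
          (2 : ℝ) ^ ((h - 1) * (ℓ' - ℓ)) *
            ((2 : ℝ) ^ (h * (h - ℓ' + 1)) - (2 : ℝ) ^ (h * (h - ℓ'))) ≤
        (2 : ℝ) ^ (h * (h - ℓ + 1))) := by
  exact ⟨routableOn_strict_descendants,
    fun l _ hl => sum_levels_below_le_cap h l (Nat.one_le_of_lt hh) hl⟩
end

section
/- For every vertex v of T^h_FG, the constant vector (1/2, …, 1/2) ∈ ℝ^V lies in K_I({v}); that is, the all-halves vector is a convex combination of indicator vectors of sets that are routable on the single edge e_v. Consequently the all-halves vector lies in P^1. -/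
open Finset

theorem FGprefix.eq_of_length_le {h : ℕ} {v w : FGV h} (hp : FGprefix v w)
    (hle : (w.1 : ℕ) ≤ v.1) : w = v := by
  obtain ⟨n, g⟩ := v
  obtain ⟨k, f⟩ := w
  obtain ⟨h1, h2⟩ := hp
  obtain rfl : n = k := Fin.ext (le_antisymm h1 hle)
  congr 1
  funext i
  exact h2 i i rfl

theorem card_filter_FGprefix_le {h : ℕ} (v : FGV h) (k : Fin h) :
    #{f : Fin (k : ℕ) → Fin (2 ^ (h - 1)) | FGprefix v ⟨k, f⟩} ≤
      2 ^ ((h - 1) * ((k : ℕ) - v.1)) := by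
  have hcard : #(univ : Finset (Fin ((k : ℕ) - v.1) → Fin (2 ^ (h - 1)))) =
      2 ^ ((h - 1) * ((k : ℕ) - v.1)) := by
    simp [pow_mul]
  rw [← hcard]
  refine card_le_card_of_injOn
    (fun f i => f ⟨v.1 + i, by omega⟩) (fun _ _ => by simp) ?_
  intro f hf g hg hfg
  simp only [coe_filter, mem_univ, true_and, Set.mem_ofPred_eq] at hf hg
  funext i
  by_cases hi : (i : ℕ) < v.1
  · exact (hf.2 ⟨i, hi⟩ i rfl).trans (hg.2 ⟨i, hi⟩ i rfl).symm
  · have := congrFun hfg ⟨i - v.1, by omega⟩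
    simpa [Nat.add_sub_cancel' (not_lt.mp hi)] using this

theorem FGcap_pos {h : ℕ} (v : FGV h) : 0 < FGcap v := by
  unfold FGcap; positivity

theorem FGdemand_nonneg {h : ℕ} (v : FGV h) : 0 ≤ FGdemand v := by
  unfold FGdemand
  exact sub_nonneg.mpr (pow_le_pow_right₀ one_le_two (Nat.mul_le_mul_left _ (Nat.le_succ _)))

theorem FGdemand_le_FGcap {h : ℕ} (v : FGV h) : FGdemand v ≤ FGcap v := by
  unfold FGdemand FGcap
  exact sub_le_self _ (by positivity)

/-- Capacities drop by a factor `2 ^ h` per level while the number of descendants grows by only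
`2 ^ (h - 1)`. -/
theorem pow_mul_FGcap {h : ℕ} {v w : FGV h} (hvw : (v.1 : ℕ) ≤ w.1) :
    2 ^ ((h - 1) * ((w.1 : ℕ) - v.1)) * FGcap w = FGcap v * (1 / 2) ^ ((w.1 : ℕ) - v.1) := by
  have hv := v.1.isLt
  have hw := w.1.isLt
  unfold FGcap FGlevel
  rw [one_div, inv_pow, eq_mul_inv_iff_mul_eq₀ (by positivity), ← pow_add, ← pow_add]
  congr 1
  obtain ⟨d, hd⟩ := Nat.exists_eq_add_of_le hvw
  obtain ⟨e, he⟩ := Nat.exists_eq_add_of_lt hw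
  obtain ⟨m, hm⟩ : ∃ m, h = m + 1 := ⟨h - 1, by omega⟩
  have h1 : h - ((w.1 : ℕ) + 1) + 1 = e + 1 := by omega
  have h2 : h - ((v.1 : ℕ) + 1) + 1 = d + e + 1 := by omega
  have h3 : (w.1 : ℕ) - v.1 = d := by omega
  have h4 : h - 1 = m := by omega
  rw [h1, h2, h3, h4, hm]
  ring

theorem sum_range_half_pow_sub_le_one (n m : ℕ) :
    ∑ k ∈ range m, (if n < k then (1 / 2 : ℝ) ^ (k - n) else 0) ≤ 1 := by
  suffices H : ∑ k ∈ range m, (if n < k then (1 / 2 : ℝ) ^ (k - n) else 0) =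
      1 - (1 / 2) ^ (m - 1 - n) by
    rw [H]
    exact sub_le_self _ (by positivity)
  induction m with
  | zero => simp
  | succ m ih =>
    rw [sum_range_succ, ih]
    split_ifs with hnm
    · obtain ⟨d, rfl⟩ := Nat.exists_eq_add_of_lt hnm
      have h1 : n + d + 1 - 1 - n = d := by omega
      have h2 : n + d + 1 - n = d + 1 := by omega
      have h3 : n + d + 1 + 1 - 1 - n = d + 1 := by omega
      rw [h1, h2, h3]
      ring
    · have h1 : m - 1 - n = 0 := by omega
      have h2 : m + 1 - 1 - n = 0 := by omega
      rw [h1, h2, add_zero]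

theorem routableOn_singleton {h : ℕ} (v : FGV h) : RoutableOn {v} v := by
  unfold RoutableOn
  calc ∑ w ∈ ({v} : Finset (FGV h)).filter (fun w => FGprefix v w), FGdemand w
      ≤ ∑ w ∈ {v}, FGdemand w :=
        sum_le_sum_of_subset_of_nonneg (filter_subset _ _) fun w _ _ => FGdemand_nonneg w
    _ ≤ FGcap v := by simpa using FGdemand_le_FGcap v

theorem routableOn_erase {h : ℕ} (v : FGV h) : RoutableOn (univ.erase v) v := by
  unfold RoutableOn
  have hfilter : (univ.erase v).filter (fun w => FGprefix v w) =
      univ.filter fun w : FGV h => (v.1 : ℕ) < w.1 ∧ FGprefix v w := by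
    ext w
    simp only [mem_filter, mem_erase, mem_univ, and_true, true_and]
    refine and_congr_left fun hp => ⟨fun hne => ?_, ?_⟩
    · exact not_le.mp fun hle => hne (hp.eq_of_length_le hle)
    · rintro hlt rfl
      exact lt_irrefl _ hlt
  rw [hfilter, sum_filter, Fintype.sum_sigma]
  have hlevel (k : Fin h) :
      (∑ f : Fin (k : ℕ) → Fin (2 ^ (h - 1)),
        if (v.1 : ℕ) < k ∧ FGprefix v ⟨k, f⟩ then FGdemand (⟨k, f⟩ : FGV h) else 0) ≤
      FGcap v * if (v.1 : ℕ) < k then (1 / 2 : ℝ) ^ ((k : ℕ) - v.1) else 0 := by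
    split_ifs with hk
    · have : NeZero (2 ^ (h - 1)) := ⟨by positivity⟩
      let w : FGV h := ⟨k, fun _ => 0⟩
      simp only [hk, true_and]
      rw [← sum_filter]
      calc ∑ f : Fin (k : ℕ) → Fin (2 ^ (h - 1)) with FGprefix v ⟨k, f⟩,
            FGdemand (⟨k, f⟩ : FGV h)
          ≤ #{f : Fin (k : ℕ) → Fin (2 ^ (h - 1)) | FGprefix v ⟨k, f⟩} • FGcap w :=
            sum_le_card_nsmul _ _ _ fun f _ => FGdemand_le_FGcap (⟨k, f⟩ : FGV h)
        _ ≤ 2 ^ ((h - 1) * ((k : ℕ) - v.1)) * FGcap w := by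
            rw [nsmul_eq_mul]
            gcongr
            · exact (FGcap_pos w).le
            · exact_mod_cast card_filter_FGprefix_le v k
        _ = FGcap v * (1 / 2) ^ ((k : ℕ) - v.1) := pow_mul_FGcap (w := w) hk.le
    · simp [hk]
  refine (sum_le_sum fun k _ => hlevel k).trans ?_
  rw [← mul_sum,
    Fin.sum_univ_eq_sum_range (fun k => if (v.1 : ℕ) < k then (1 / 2 : ℝ) ^ (k - v.1) else 0)]
  exact mul_le_of_le_one_right (FGcap_pos v).le (sum_range_half_pow_sub_le_one _ _)

theorem half_mem_FGKI_singleton {h : ℕ} (v : FGV h) :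
    (fun _ : FGV h => (1 / 2 : ℝ)) ∈ FGKI ({v} : Finset (FGV h)) := by
  have hmem (X : Finset (FGV h)) (hX : RoutableOn X v) :
      (fun w => if w ∈ X then (1 : ℝ) else 0) ∈ FGKI ({v} : Finset (FGV h)) :=
    subset_convexHull ℝ _ ⟨X, by simpa [SRoutable] using hX, rfl⟩
  have hconv : Convex ℝ (FGKI ({v} : Finset (FGV h))) := convex_convexHull ℝ _
  have hmid := hconv (hmem _ (routableOn_singleton v))
    (hmem _ (routableOn_erase v)) (a := 1 / 2) (b := 1 / 2) (by norm_num) (by norm_num)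
    (by norm_num)
  convert hmid using 1
  funext w
  by_cases hw : w = v <;> simp [hw]

theorem half_in_P1 (h : ℕ) (hh : 2 ≤ h) :
    (∀ v : FGV h, (fun _ : FGV h => (1 / 2 : ℝ)) ∈ FGKI ({v} : Finset (FGV h))) ∧
    (fun _ : FGV h => (1 / 2 : ℝ)) ∈ FGP h 1 := by
  refine ⟨half_mem_FGKI_singleton, ?_⟩
  simp only [FGP, Set.mem_iInter, Set.mem_ofPred_eq]
  intro S hS
  obtain ⟨v, rfl⟩ := card_eq_one.mp hS
  exact half_mem_FGKI_singleton v
end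

section
/- Let c ≥ 1, let v ∈ V, and let W ⊆ V be a subtree rooted at v: v ∈ W, every w ∈ W satisfies v ⪯ w, and for every w ∈ W with w ≠ v the parent of w is in W. For j ≥ 1 let L_j = {w ∈ W : the level of w equals the level of v plus j−1} (the j-th layer of W, so L_1 = {v}). If |L_j| ≤ 2^{h(c−1)} for every j ≥ 1, then the layered colouring with c colours is valid: for each i ∈ {1,…,c}, the set X_i = ⋃_{j ≥ 1, j ≡ i (mod c)} L_j is W-routable. In particular W can be partitioned into at most c sets, each of which is W-routable. -/
open Finset

theorem FGlevel_le {h : ℕ} (w : FGV h) : FGlevel w ≤ h := w.1.isLt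

theorem FGprefix.level_le {h : ℕ} {u w : FGV h} (huw : FGprefix u w) :
    FGlevel u ≤ FGlevel w := Nat.succ_le_succ huw.1

theorem FGdemand_eq_of_level {h a : ℕ} {w : FGV h} (hw : FGlevel w = a) :
    FGdemand w = 2 ^ (h * (h - a + 1)) - 2 ^ (h * (h - a)) := by
  rw [FGdemand, hw]

theorem two_pow_mul_sub_nonneg (h n : ℕ) :
    (0 : ℝ) ≤ 2 ^ (h * (n + 1)) - 2 ^ (h * n) :=
  sub_nonneg.2 (pow_le_pow_right₀ one_le_two (Nat.mul_le_mul_left h n.le_succ))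

/-- Two vertices of the same level that extend `u` and agree beyond `u` are equal. -/
theorem FGV.eq_of_prefix {h : ℕ} {u w x : FGV h} (hw : FGprefix u w) (hx : FGprefix u x)
    (hlen : (w.1 : ℕ) = x.1)
    (hval : ∀ (i : ℕ) (hi : i < w.1) (hi' : i < x.1), (u.1 : ℕ) ≤ i →
      w.2 ⟨i, hi⟩ = x.2 ⟨i, hi'⟩) : w = x := by
  obtain ⟨k, f⟩ := w
  obtain ⟨l, g⟩ := x
  obtain rfl : k = l := Fin.ext hlen
  congr 1
  funext ⟨i, hi⟩
  rcases lt_or_ge i (u.1 : ℕ) with hiu | hiu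
  · exact (hw.2 ⟨i, hiu⟩ ⟨i, hi⟩ rfl).trans (hx.2 ⟨i, hiu⟩ ⟨i, hi⟩ rfl).symm
  · exact hval i hi hi hiu

/-- A vertex has at most `2^{(h-1)r}` descendants `r` levels below it. -/
theorem card_descendants_le {h : ℕ} (u : FGV h) (r : ℕ) (Y : Finset (FGV h))
    (hY : ∀ w ∈ Y, FGprefix u w ∧ FGlevel w = FGlevel u + r) :
    Y.card ≤ 2 ^ ((h - 1) * r) := by
  have hlen : ∀ w ∈ Y, (w.1 : ℕ) = u.1 + r := fun w hw => by
    have := (hY w hw).2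
    unfold FGlevel at this
    omega
  have hcard : (univ : Finset (Fin r → Fin (2 ^ (h - 1)))).card = 2 ^ ((h - 1) * r) := by
    simp [pow_mul]
  rw [← hcard]
  refine Finset.card_le_card_of_injOn
    (fun w i => if hi : (u.1 : ℕ) + i < w.1 then w.2 ⟨u.1 + i, hi⟩ else 0)
    (fun _ _ => mem_coe.2 (mem_univ _)) ?_
  intro w hw x hx hwx
  have hw' := hlen w hw
  have hx' := hlen x hx
  refine FGV.eq_of_prefix (hY w hw).1 (hY x hx).1 (hw'.trans hx'.symm) ?_
  intro i hi hi' hui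
  obtain ⟨j, rfl⟩ := Nat.exists_eq_add_of_le hui
  have := congrFun hwx ⟨j, by omega⟩
  simpa [hi, hi'] using this

/-- If every layer of `Z` has at most `2^{h(c-1)}` vertices and all levels in `Z` are at least
`L + c`, then the total demand of `Z` is at most `2^{h(h-L)}`. -/
theorem sum_demand_le_of_layers {h c L : ℕ} (hc : 1 ≤ c) (Z : Finset (FGV h))
    (hZ : ∀ w ∈ Z, L + c ≤ FGlevel w)
    (hcard : ∀ a, L + c ≤ a → (Z.filter (fun w => FGlevel w = a)).card ≤ 2 ^ (h * (c - 1))) :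
    ∑ w ∈ Z, FGdemand w ≤ 2 ^ (h * (h - L)) := by
  rcases lt_or_ge h (L + c) with hL | hL
  · have hempty : Z = ∅ := Finset.eq_empty_of_forall_notMem fun w hw => by
      have := hZ w hw
      have := FGlevel_le w
      omega
    rw [hempty, sum_empty]
    positivity
  have hmaps : ∀ w ∈ Z, FGlevel w ∈ Ico (L + c) (h + 1) := fun w hw =>
    mem_Ico.2 ⟨hZ w hw, Nat.lt_succ_of_le (FGlevel_le w)⟩
  rw [← Finset.sum_fiberwise_of_maps_to hmaps]
  have hlayer : ∀ a ∈ Ico (L + c) (h + 1),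
      ∑ w ∈ Z.filter (fun w => FGlevel w = a), FGdemand w ≤
        -(2 ^ (h * (h + c - (a + 1))) : ℝ) - -2 ^ (h * (h + c - a)) := by
    intro a ha
    obtain ⟨ha, ha'⟩ := mem_Ico.1 ha
    rw [Finset.sum_congr rfl fun w hw => FGdemand_eq_of_level (mem_filter.1 hw).2,
      sum_const, nsmul_eq_mul]
    have hle : ((Z.filter (fun w => FGlevel w = a)).card : ℝ) ≤ 2 ^ (h * (c - 1)) := by
      exact_mod_cast hcard a ha
    refine (mul_le_mul_of_nonneg_right hle (two_pow_mul_sub_nonneg h (h - a))).trans_eq ?_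
    have e₁ : h + c - (a + 1) = (c - 1) + (h - a) := by omega
    have e₂ : h + c - a = (c - 1) + (h - a + 1) := by omega
    rw [e₁, e₂, mul_add, mul_add h (c - 1), pow_add, pow_add]
    ring
  refine (Finset.sum_le_sum hlayer).trans ?_
  rw [Finset.sum_Ico_sub (fun a => -(2 ^ (h * (h + c - a)) : ℝ)) (by omega)]
  have e : h + c - (L + c) = h - L := by omega
  rw [e]
  have : (0 : ℝ) ≤ 2 ^ (h * (h + c - (h + 1))) := by positivity
  linarith

/-- A set of vertices whose levels agree modulo `c` and whose layers have at most
`2^{h(c-1)}` vertices is routable on every edge. -/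
theorem routableOn_of_layers {h c : ℕ} (hc : 1 ≤ c) (u : FGV h) (X : Finset (FGV h))
    (hmod : ∀ w ∈ X, ∀ x ∈ X, FGlevel w ≡ FGlevel x [MOD c])
    (hcard : ∀ a, (X.filter (fun w => FGlevel w = a)).card ≤ 2 ^ (h * (c - 1))) :
    RoutableOn X u := by
  unfold RoutableOn FGcap
  set Y := X.filter (fun w => FGprefix u w) with hY
  rcases Y.eq_empty_or_nonempty with hempty | hne
  · rw [hempty, sum_empty]
    positivity
  obtain ⟨m, hm, hmin⟩ := Finset.exists_min_image Y FGlevel hne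
  have hmX := mem_filter.1 hm
  obtain ⟨r, hr⟩ := Nat.exists_eq_add_of_le hmX.2.level_le
  rw [← Finset.sum_filter_add_sum_filter_not Y (fun w => FGlevel w = FGlevel m)]
  have htop : ∑ w ∈ Y.filter (fun w => FGlevel w = FGlevel m), FGdemand w ≤
      2 ^ ((h - 1) * r) *
        (2 ^ (h * (h - FGlevel m + 1)) - 2 ^ (h * (h - FGlevel m))) := by
    rw [Finset.sum_congr rfl fun w hw => FGdemand_eq_of_level (mem_filter.1 hw).2,
      sum_const, nsmul_eq_mul]
    refine mul_le_mul_of_nonneg_right ?_ (two_pow_mul_sub_nonneg h _)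
    have := card_descendants_le u r (Y.filter (fun w => FGlevel w = FGlevel m)) fun w hw =>
      ⟨(mem_filter.1 (mem_filter.1 hw).1).2, (mem_filter.1 hw).2.trans hr⟩
    exact_mod_cast this
  have hrest : ∑ w ∈ Y.filter (fun w => ¬FGlevel w = FGlevel m), FGdemand w ≤
      2 ^ (h * (h - FGlevel m)) := by
    refine sum_demand_le_of_layers hc _ (fun w hw => ?_) fun a _ => ?_
    · obtain ⟨hwY, hne⟩ := mem_filter.1 hw
      have hlt : FGlevel m < FGlevel w := lt_of_le_of_ne (hmin w hwY) (Ne.symm hne)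
      have hdvd := (Nat.modEq_iff_dvd' hlt.le).1
        (hmod m hmX.1 w (mem_filter.1 hwY).1)
      have := Nat.le_of_dvd (Nat.sub_pos_of_lt hlt) hdvd
      omega
    · exact (card_le_card (filter_subset_filter _
        ((filter_subset _ _).trans (filter_subset _ _)))).trans (hcard a)
  have hone : (1 : ℝ) ≤ 2 ^ ((h - 1) * r) := one_le_pow₀ one_le_two
  have hpos : (0 : ℝ) ≤ 2 ^ (h * (h - FGlevel m)) := by positivity
  have hcap : (2 : ℝ) ^ ((h - 1) * r) * 2 ^ (h * (h - FGlevel m + 1)) ≤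
      2 ^ (h * (h - FGlevel u + 1)) := by
    have hmh := FGlevel_le m
    have e : h - FGlevel u + 1 = r + (h - FGlevel m + 1) := by omega
    rw [← pow_add, e, mul_add h r]
    exact pow_le_pow_right₀ one_le_two
      (Nat.add_le_add_right (Nat.mul_le_mul_right r (Nat.sub_le h 1)) _)
  nlinarith [mul_le_mul_of_nonneg_right hone hpos]

theorem layered_colouring (h : ℕ) (hh : 2 ≤ h) (c : ℕ) (hc : 1 ≤ c)
    (v : FGV h) (W : Finset (FGV h)) (hvW : v ∈ W)
    (hpre : ∀ w ∈ W, FGprefix v w)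
    (hparent : ∀ w ∈ W, w ≠ v →
      ∃ p ∈ W, FGprefix p w ∧ FGlevel p + 1 = FGlevel w)
    (hlayer : ∀ j : ℕ, 1 ≤ j →
      (W.filter (fun w => FGlevel w = FGlevel v + j - 1)).card ≤ 2 ^ (h * (c - 1))) :
    (∀ i : ℕ, 1 ≤ i → i ≤ c →
        SRoutable (W.filter (fun w => (FGlevel w - FGlevel v + 1) % c = i % c)) W) ∧
    (∃ 𝒳 : Finset (Finset (FGV h)), 𝒳.card ≤ c ∧
      (∀ X ∈ 𝒳, X ⊆ W) ∧
      (∀ w ∈ W, ∃ X ∈ 𝒳, w ∈ X) ∧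
      (∀ X ∈ 𝒳, ∀ Y ∈ 𝒳, X ≠ Y → Disjoint X Y) ∧
      (∀ X ∈ 𝒳, SRoutable X W)) := by
  have hcolour : ∀ s : ℕ,
      SRoutable (W.filter (fun w => (FGlevel w - FGlevel v + 1) % c = s)) W := by
    intro s u _
    refine routableOn_of_layers hc u _ (fun w hw x hx => ?_) fun a => ?_
    · obtain ⟨hw, hws⟩ := mem_filter.1 hw
      obtain ⟨hx, hxs⟩ := mem_filter.1 hx
      have hmod : FGlevel w - FGlevel v + 1 ≡ FGlevel x - FGlevel v + 1 [MOD c] :=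
        hws.trans hxs.symm
      have := (Nat.ModEq.add_right_cancel' 1 hmod).add_right (FGlevel v)
      rwa [Nat.sub_add_cancel (hpre w hw).level_le,
        Nat.sub_add_cancel (hpre x hx).level_le] at this
    · refine (card_le_card fun w hw => ?_).trans
        (hlayer (a - FGlevel v + 1) (Nat.le_add_left 1 _))
      obtain ⟨hwX, hwa⟩ := mem_filter.1 hw
      have hwW := (mem_filter.1 hwX).1
      have := (hpre w hwW).level_le
      exact mem_filter.2 ⟨hwW, by omega⟩
  refine ⟨fun i _ _ => hcolour (i % c),
    (range c).image fun s => W.filter (fun w => (FGlevel w - FGlevel v + 1) % c = s),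
    card_image_le.trans_eq (card_range c), ?_, ?_, ?_, ?_⟩
  · intro X hX
    obtain ⟨s, _, rfl⟩ := mem_image.1 hX
    exact filter_subset _ _
  · intro w hw
    exact ⟨_, mem_image_of_mem _ (mem_range.2 (Nat.mod_lt (FGlevel w - FGlevel v + 1) hc)),
      mem_filter.2 ⟨hw, rfl⟩⟩
  · intro X hX Y hY hXY
    obtain ⟨s, _, rfl⟩ := mem_image.1 hX
    obtain ⟨t, _, rfl⟩ := mem_image.1 hY
    refine disjoint_filter.2 fun w _ hs ht => hXY ?_
    rw [← hs, ← ht]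
  · intro X hX
    obtain ⟨s, _, rfl⟩ := mem_image.1 hX
    exact hcolour s
end

section
/- Let v ∈ V be a vertex in level j and let ℓ ≥ 1, and set W = {w ∈ V : v ⪯ w and level(w) ≤ j + ℓ − 1} (the subtree T_v^ℓ). Then feasibility is determined locally: every X ⊆ W that is W-routable (i.e. routable on e_w for every w ∈ W) is in fact routable on every edge of T^h_FG. -/
open Finset

theorem FGprefix.refl {h : ℕ} (v : FGV h) : FGprefix v v :=
  ⟨le_rfl, fun i j hij => by rw [Fin.ext hij]⟩

/-- Two prefixes of the same sequence are comparable: the shorter is a prefix of the longer. -/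
theorem FGprefix.of_length_le {h : ℕ} {v u w : FGV h} (hv : FGprefix v w) (hu : FGprefix u w)
    (hle : (v.1 : ℕ) ≤ (u.1 : ℕ)) : FGprefix v u := by
  refine ⟨hle, fun i j hij => ?_⟩
  have hj : (j : ℕ) < (w.1 : ℕ) := j.2.trans_le hu.1
  rw [← hu.2 j ⟨j, hj⟩ rfl, hv.2 i ⟨j, hj⟩ hij]

/-- Capacities do not increase with the level. -/
theorem FGcap_le_of_length_le {h : ℕ} {u v : FGV h} (hle : (u.1 : ℕ) ≤ (v.1 : ℕ)) :
    FGcap v ≤ FGcap u := by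
  refine pow_le_pow_right₀ one_le_two (Nat.mul_le_mul_left h ?_)
  unfold FGlevel
  omega

theorem local_feasibility (h : ℕ) (hh : 2 ≤ h) (v : FGV h) (ℓ : ℕ) (hℓ : 1 ≤ ℓ) :
    ∀ X ⊆ Finset.univ.filter
        (fun w : FGV h => FGprefix v w ∧ FGlevel w ≤ FGlevel v + ℓ - 1),
      SRoutable X (Finset.univ.filter
        (fun w : FGV h => FGprefix v w ∧ FGlevel w ≤ FGlevel v + ℓ - 1)) →
      Routable X := by
  intro X hX hS u
  by_cases hne : ∃ w ∈ X, FGprefix u w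
  · obtain ⟨w, hwX, huw⟩ := hne
    obtain ⟨hvw, hlevel⟩ := (Finset.mem_filter.1 (hX hwX)).2
    rcases le_total (v.1 : ℕ) (u.1 : ℕ) with hle | hle
    · refine hS u (Finset.mem_filter.2
        ⟨Finset.mem_univ u, hvw.of_length_le huw hle, le_trans ?_ hlevel⟩)
      exact Nat.succ_le_succ huw.1
    · have hv : RoutableOn X v := hS v (Finset.mem_filter.2
        ⟨Finset.mem_univ v, FGprefix.refl v, by omega⟩)
      refine le_trans (Finset.sum_le_sum_of_subset_of_nonneg (fun x hx => ?_)
        fun x _ _ => FGdemand_nonneg x) (hv.trans (FGcap_le_of_length_le hle))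
      have hxX := (Finset.mem_filter.1 hx).1
      exact Finset.mem_filter.2 ⟨hxX, (Finset.mem_filter.1 (hX hxX)).2.1⟩
  · push Not at hne
    unfold RoutableOn
    rw [Finset.filter_false_of_mem hne, Finset.sum_empty]
    exact pow_nonneg zero_le_two _
end

section
/- Assume that every routable set X ⊆ V of T^h_FG has total profit ∑_{v ∈ X} w_v ≤ 2. Let ℓ ≥ 1 and let t satisfy n(ℓ) ≤ t ≤ |V|, where n(ℓ) = ∑_{i=0}^{ℓ−1} 2^{(h−1)i}. Then for every x ∈ P^t and every integer i with 0 ≤ i < ⌈h/ℓ⌉, the profit of x restricted to levels iℓ+1 through min((i+1)ℓ, h) is at most 2: ∑_{w ∈ V, iℓ+1 ≤ level(w) ≤ min((i+1)ℓ, h)} w_w x_w ≤ 2. -/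
open Finset

theorem FGprefix.trans {h : ℕ} {u v w : FGV h} (huv : FGprefix u v) (hvw : FGprefix v w) :
    FGprefix u w := by
  refine ⟨huv.1.trans hvw.1, fun i j hij => ?_⟩
  have hi : (i : ℕ) < (v.1 : ℕ) := i.2.trans_le huv.1
  rw [hvw.2 ⟨i, hi⟩ j hij, huv.2 i ⟨i, hi⟩ rfl]

theorem FGprefix.of_common {h : ℕ} {u v w : FGV h} (huw : FGprefix u w) (hvw : FGprefix v w)
    (hlen : (u.1 : ℕ) ≤ v.1) : FGprefix u v := by
  refine ⟨hlen, fun i j hij => ?_⟩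
  have hj : (j : ℕ) < (w.1 : ℕ) := j.2.trans_le hvw.1
  rw [← hvw.2 j ⟨j, hj⟩ rfl, ← huw.2 i ⟨j, hj⟩ hij]

theorem FGV.ext_of_entries {h : ℕ} {u v : FGV h} (hlen : (u.1 : ℕ) = v.1)
    (hent : ∀ (j : ℕ) (hu : j < u.1) (hv : j < v.1), u.2 ⟨j, hu⟩ = v.2 ⟨j, hv⟩) : u = v := by
  obtain ⟨k, f⟩ := u
  obtain ⟨k', g⟩ := v
  obtain rfl : k = k' := Fin.ext hlen
  congr 1
  funext j
  exact hent j j.2 j.2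

theorem FGprefix.eq_of_length_eq {h : ℕ} {u v : FGV h} (huv : FGprefix u v)
    (hlen : (u.1 : ℕ) = v.1) : u = v :=
  FGV.ext_of_entries hlen fun _ hu hv => (huv.2 ⟨_, hu⟩ ⟨_, hv⟩ rfl).symm

/-- The prefix of `w` of length `a` (or `w` itself if `w` is shorter than `a`). -/
def FGtrunc {h : ℕ} (a : ℕ) (w : FGV h) : FGV h :=
  ⟨⟨min a w.1, (min_le_right _ _).trans_lt w.1.2⟩,
    fun j => w.2 ⟨j, j.2.trans_le (min_le_right _ _)⟩⟩

theorem FGtrunc_length {h a : ℕ} {w : FGV h} (ha : a ≤ w.1) : ((FGtrunc a w).1 : ℕ) = a :=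
  min_eq_left ha

theorem FGtrunc_prefix {h : ℕ} (a : ℕ) (w : FGV h) : FGprefix (FGtrunc a w) w := by
  refine ⟨min_le_right _ _, fun i j hij => ?_⟩
  exact congrArg w.2 (Fin.ext hij.symm)

theorem FGprefix.eq_FGtrunc {h a : ℕ} {u w : FGV h} (huw : FGprefix u w)
    (hu : (u.1 : ℕ) = a) : u = FGtrunc a w := by
  have hlen : ((FGtrunc a w).1 : ℕ) = a := FGtrunc_length (hu ▸ huw.1)
  exact (huw.of_common (FGtrunc_prefix a w) (by omega)).eq_of_length_eq (by omega)

theorem card_descendants_le_s15 {h : ℕ} (v : FGV h) (k : ℕ) :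
    #{w : FGV h | (w.1 : ℕ) = k ∧ FGprefix v w} ≤ 2 ^ ((h - 1) * (k - v.1)) := by
  have hcard : #(univ : Finset (Fin (k - v.1) → Fin (2 ^ (h - 1)))) =
      2 ^ ((h - 1) * (k - v.1)) := by
    simp [pow_mul]
  rw [← hcard]
  refine card_le_card_of_injOn
    (fun w j => if hj : (v.1 : ℕ) + j < w.1 then w.2 ⟨v.1 + j, hj⟩ else ⟨0, by positivity⟩)
    (fun _ _ => mem_coe.2 (mem_univ _)) fun w hw w' hw' heq => ?_
  simp only [coe_filter, mem_univ, true_and, Set.mem_ofPred_eq] at hw hw'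
  refine FGV.ext_of_entries (hw.1.trans hw'.1.symm) fun j hj hj' => ?_
  rcases lt_or_ge j (v.1 : ℕ) with hjv | hjv
  · rw [hw.2.2 ⟨j, hjv⟩ ⟨j, hj⟩ rfl, hw'.2.2 ⟨j, hjv⟩ ⟨j, hj'⟩ rfl]
  · have hentry := congrFun heq ⟨j - v.1, by omega⟩
    simpa [Nat.add_sub_cancel' hjv, hj, hj'] using hentry

theorem sum_FGdemand_le_of_subset {h : ℕ} {X Y : Finset (FGV h)} {v : FGV h}
    (hX : RoutableOn X v) (hY : ∀ w ∈ Y, w ∈ X ∧ FGprefix v w) :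
    ∑ w ∈ Y, FGdemand w ≤ FGcap v :=
  (sum_le_sum_of_subset_of_nonneg (fun w hw => mem_filter.2 (hY w hw))
    fun w _ _ => FGdemand_nonneg w).trans hX

/-- The total capacity of the descendants of `v` of length `a` is at most the capacity of `v`. -/
theorem descendant_cap_le {h a : ℕ} (v : FGV h) (hva : (v.1 : ℕ) ≤ a) (hah : a < h) :
    (2 : ℝ) ^ ((h - 1) * (a - v.1)) * 2 ^ (h * (h - a)) ≤ FGcap v := by
  rw [FGcap, FGlevel, ← pow_add]
  refine pow_le_pow_right₀ one_le_two ?_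
  have hsplit : h - ((v.1 : ℕ) + 1) + 1 = (a - v.1) + (h - a) := by omega
  rw [hsplit, mul_add]
  gcongr
  omega

/-- The vertices whose length lies in `[a, a + ℓ)`. -/
def FGlayer (h a ℓ : ℕ) : Finset (FGV h) := {w | a ≤ (w.1 : ℕ) ∧ (w.1 : ℕ) < a + ℓ}

/-- The part of a layer below the vertex `r`. -/
def FGblock {h : ℕ} (a ℓ : ℕ) (r : FGV h) : Finset (FGV h) :=
  {w ∈ FGlayer h a ℓ | FGtrunc a w = r}

theorem mem_FGblock {h a ℓ : ℕ} {r w : FGV h} :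
    w ∈ FGblock a ℓ r ↔ (a ≤ (w.1 : ℕ) ∧ (w.1 : ℕ) < a + ℓ) ∧ FGtrunc a w = r := by
  simp [FGblock, FGlayer]

theorem card_FGblock_le {h : ℕ} (a ℓ : ℕ) (r : FGV h) :
    #(FGblock a ℓ r) ≤ ∑ j ∈ range ℓ, 2 ^ ((h - 1) * j) := by
  have hsub : FGblock a ℓ r ⊆ (range ℓ).biUnion
      fun j => {w : FGV h | (w.1 : ℕ) = r.1 + j ∧ FGprefix r w} := by
    intro w hw
    obtain ⟨⟨ha, hlt⟩, rfl⟩ := mem_FGblock.1 hw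
    have hlen := FGtrunc_length ha
    simp only [mem_biUnion, mem_range, mem_filter, mem_univ, true_and]
    exact ⟨w.1 - a, by omega, by omega, FGtrunc_prefix a w⟩
  refine (card_le_card hsub).trans (card_biUnion_le.trans (sum_le_sum fun j _ => ?_))
  simpa using card_descendants_le_s15 r (r.1 + j)

/-- Sets routable on the blocks of a layer glue to a routable set. -/
theorem routable_glue {h a ℓ : ℕ} (hℓ : 1 ≤ ℓ) (X : FGV h → Finset (FGV h))
    (hX : ∀ r, SRoutable (X r) (FGblock a ℓ r)) :
    Routable {w ∈ FGlayer h a ℓ | w ∈ X (FGtrunc a w)} := by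
  intro v
  rw [RoutableOn, filter_filter]
  set Z := {w ∈ FGlayer h a ℓ | w ∈ X (FGtrunc a w) ∧ FGprefix v w} with hZ
  have hmem : ∀ w, w ∈ Z ↔ (a ≤ (w.1 : ℕ) ∧ (w.1 : ℕ) < a + ℓ) ∧
      w ∈ X (FGtrunc a w) ∧ FGprefix v w := by
    simp [hZ, FGlayer]
  rcases le_or_gt a (v.1 : ℕ) with hav | hva
  · rcases lt_or_ge (v.1 : ℕ) (a + ℓ) with hvl | hvl
    · refine sum_FGdemand_le_of_subset (hX (FGtrunc a v) v (mem_FGblock.2 ⟨⟨hav, hvl⟩, rfl⟩))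
        fun w hw => ?_
      obtain ⟨-, hwX, hvw⟩ := (hmem w).1 hw
      rw [((FGtrunc_prefix a v).trans hvw).eq_FGtrunc (FGtrunc_length hav)]
      exact ⟨hwX, hvw⟩
    · have hempty : Z = ∅ := by
        refine eq_empty_of_forall_notMem fun w hw => ?_
        obtain ⟨hlen, -, hvw⟩ := (hmem w).1 hw
        have := hvw.1
        omega
      rw [hempty, sum_empty, FGcap]
      positivity
  · rcases Z.eq_empty_or_nonempty with hempty | ⟨w₀, hw₀⟩
    · rw [hempty, sum_empty, FGcap]
      positivity
    have hah : a < h := ((hmem w₀).1 hw₀).1.1.trans_lt w₀.1.2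
    set R : Finset (FGV h) := {r : FGV h | (r.1 : ℕ) = a ∧ FGprefix v r} with hR
    have hmaps : ∀ w ∈ Z, FGtrunc a w ∈ R := by
      intro w hw
      obtain ⟨⟨ha, -⟩, -, hvw⟩ := (hmem w).1 hw
      have hlen := FGtrunc_length ha
      simp only [hR, mem_filter, mem_univ, true_and]
      exact ⟨hlen, hvw.of_common (FGtrunc_prefix a w) (by omega)⟩
    rw [← sum_fiberwise_of_maps_to hmaps]
    have hfiber : ∀ r ∈ R, ∑ w ∈ Z with FGtrunc a w = r, FGdemand w ≤
        (2 : ℝ) ^ (h * (h - a)) := by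
      intro r hr
      simp only [hR, mem_filter, mem_univ, true_and] at hr
      have hcap : FGcap r = (2 : ℝ) ^ (h * (h - a)) := by
        rw [FGcap, FGlevel, hr.1]
        congr 2
        omega
      have hself : FGtrunc a r = r :=
        (FGtrunc_prefix a r).eq_of_length_eq ((FGtrunc_length hr.1.ge).trans hr.1.symm)
      rw [← hcap]
      refine sum_FGdemand_le_of_subset
        (hX r r (mem_FGblock.2 ⟨⟨hr.1.ge, by omega⟩, hself⟩)) fun w hw => ?_
      obtain ⟨hwZ, rfl⟩ := mem_filter.1 hw
      exact ⟨((hmem w).1 hwZ).2.1, FGtrunc_prefix a w⟩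
    refine (sum_le_card_nsmul _ _ _ hfiber).trans ?_
    rw [nsmul_eq_mul]
    refine le_trans ?_ (descendant_cap_le v hva.le hah)
    gcongr
    exact_mod_cast card_descendants_le_s15 v a

theorem exists_SRoutable_of_mem_FGKI {h : ℕ} {S : Finset (FGV h)} {x : FGV h → ℝ}
    (hx : x ∈ FGKI S) (B : Finset (FGV h)) (p : FGV h → ℝ) :
    ∃ X : Finset (FGV h), SRoutable X S ∧
      ∑ w ∈ B, p w * x w ≤ ∑ w ∈ B, p w * if w ∈ X then (1 : ℝ) else 0 := by
  let f : (FGV h → ℝ) →ₗ[ℝ] ℝ := ∑ w ∈ B, p w • LinearMap.proj w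
  have hf : ∀ y, f y = ∑ w ∈ B, p w * y w := fun y => by simp [f]
  obtain ⟨_, ⟨X, hX, rfl⟩, hle⟩ :=
    (f.convexOn (convex_convexHull ℝ _)).exists_ge_of_mem_convexHull
      (subset_convexHull ℝ _) hx
  exact ⟨X, hX, by simpa only [hf] using hle⟩

theorem layer_profit_bound (h : ℕ) (hh : 2 ≤ h)
    (hrout : ∀ X : Finset (FGV h), Routable X → ∑ w ∈ X, FGprofit w ≤ 2)
    (ℓ t : ℕ) (hℓ : 1 ≤ ℓ)
    (hnℓ : ∑ i ∈ Finset.range ℓ, 2 ^ ((h - 1) * i) ≤ t)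
    (ht : t ≤ Fintype.card (FGV h))
    (x : FGV h → ℝ) (hx : x ∈ FGP h t) :
    ∀ i : ℕ, i < ⌈(h : ℝ) / (ℓ : ℝ)⌉₊ →
      ∑ w ∈ Finset.univ.filter
          (fun w : FGV h => i * ℓ + 1 ≤ FGlevel w ∧ FGlevel w ≤ min ((i + 1) * ℓ) h),
        FGprofit w * x w ≤ 2 := by
  intro i _
  have hlayer : Finset.univ.filter
      (fun w : FGV h => i * ℓ + 1 ≤ FGlevel w ∧ FGlevel w ≤ min ((i + 1) * ℓ) h) =
      FGlayer h (i * ℓ) ℓ := by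
    ext w
    have hlt := w.1.2
    simp only [FGlayer, FGlevel, mem_filter, mem_univ, true_and, add_mul, one_mul, le_min_iff]
    omega
  rw [hlayer]
  set a := i * ℓ
  have hblock : ∀ r : FGV h, ∃ X : Finset (FGV h), SRoutable X (FGblock a ℓ r) ∧
      ∑ w ∈ FGblock a ℓ r, FGprofit w * x w ≤
        ∑ w ∈ FGblock a ℓ r, FGprofit w * if w ∈ X then (1 : ℝ) else 0 := by
    intro r
    obtain ⟨S, hsub, hcard⟩ := exists_superset_card_eq ((card_FGblock_le a ℓ r).trans hnℓ) ht
    obtain ⟨X, hX, hle⟩ :=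
      exists_SRoutable_of_mem_FGKI (Set.mem_iInter₂.1 hx S hcard) (FGblock a ℓ r) FGprofit
    exact ⟨X, fun v hv => hX v (hsub hv), hle⟩
  choose X hX hle using hblock
  calc ∑ w ∈ FGlayer h a ℓ, FGprofit w * x w
      = ∑ r, ∑ w ∈ FGblock a ℓ r, FGprofit w * x w := (sum_fiberwise _ _ _).symm
    _ ≤ ∑ r, ∑ w ∈ FGblock a ℓ r, FGprofit w * if w ∈ X r then (1 : ℝ) else 0 :=
        sum_le_sum fun r _ => hle r
    _ = ∑ r, ∑ w ∈ FGblock a ℓ r, FGprofit w * if w ∈ X (FGtrunc a w) then (1 : ℝ) else 0 :=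
        sum_congr rfl fun r _ => sum_congr rfl fun w hw => by rw [(mem_FGblock.1 hw).2]
    _ = ∑ w ∈ FGlayer h a ℓ, FGprofit w * if w ∈ X (FGtrunc a w) then (1 : ℝ) else 0 :=
        sum_fiberwise _ _ _
    _ = ∑ w ∈ FGlayer h a ℓ with w ∈ X (FGtrunc a w), FGprofit w := by
        simp only [mul_ite, mul_one, mul_zero, sum_filter]
    _ ≤ 2 := hrout _ (routable_glue hℓ X hX)
end

section
/- Assume that every routable set X ⊆ V of T^h_FG has total profit ∑_{v ∈ X} w_v ≤ 2. Let ℓ ≥ 1 and let t satisfy n(ℓ) ≤ t ≤ |V|, where n(ℓ) = ∑_{i=0}^{ℓ−1} 2^{(h−1)i}. Then for every x ∈ P^t, the total profit satisfies ∑_{v ∈ V} w_v x_v ≤ 2⌈h/ℓ⌉. (Since the level-1 request alone is routable with profit 1, this bounds the integrality gap of P^t on Friggstad–Gao instances by 2⌈h/ℓ⌉ = O(h/ℓ).) -/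
open Finset

/-- The `j`-th entry of a sequence, with a default value beyond its end. -/
def FGentry {h : ℕ} (v : FGV h) (j : ℕ) : Fin (2 ^ (h - 1)) :=
  if hj : j < (v.1 : ℕ) then v.2 ⟨j, hj⟩ else ⟨0, by positivity⟩

theorem FGV_ext {h : ℕ} {v w : FGV h} (hlen : (v.1 : ℕ) = w.1)
    (hent : ∀ j < (v.1 : ℕ), FGentry v j = FGentry w j) : v = w := by
  obtain ⟨k, f⟩ := v
  obtain ⟨k', g⟩ := w
  obtain rfl : k = k' := Fin.ext hlen
  congr 1
  funext j
  simpa [FGentry] using hent j j.2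

theorem FGprefix_iff {h : ℕ} {v w : FGV h} :
    FGprefix v w ↔ (v.1 : ℕ) ≤ w.1 ∧ ∀ j < (v.1 : ℕ), FGentry w j = FGentry v j := by
  refine and_congr_right fun hle => ⟨fun H j hj => ?_, fun H i j hij => ?_⟩
  · simp only [FGentry, hj, hj.trans_le hle, dif_pos]
    exact H _ _ rfl
  · have := H i i.2
    simp only [FGentry, i.2, i.2.trans_le hle, dif_pos] at this
    rw [← this]
    exact congrArg w.2 (Fin.ext hij.symm)

/-- The prefix of length `min a |v|` of the sequence `v`. -/
def FGtake {h : ℕ} (a : ℕ) (v : FGV h) : FGV h :=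
  ⟨⟨min a v.1, (min_le_right _ _).trans_lt v.1.2⟩, fun j => FGentry v j⟩

theorem FGtake_length {h a : ℕ} {v : FGV h} (hv : a ≤ (v.1 : ℕ)) :
    ((FGtake a v).1 : ℕ) = a := by
  simp [FGtake, hv]

theorem FGentry_take {h a j : ℕ} {v : FGV h} (hv : a ≤ (v.1 : ℕ)) (hj : j < a) :
    FGentry (FGtake a v) j = FGentry v j := by
  have : j < ((FGtake a v).1 : ℕ) := by rwa [FGtake_length hv]
  rw [FGentry, dif_pos this]
  rfl

theorem FGtake_prefix {h a : ℕ} {v : FGV h} (hv : a ≤ (v.1 : ℕ)) :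
    FGprefix (FGtake a v) v := by
  rw [FGprefix_iff, FGtake_length hv]
  exact ⟨hv, fun j hj => (FGentry_take hv hj).symm⟩

theorem FGtake_eq_of_prefix {h a : ℕ} {v w : FGV h} (hv : a ≤ (v.1 : ℕ))
    (hvw : FGprefix v w) : FGtake a w = FGtake a v := by
  rw [FGprefix_iff] at hvw
  have hw := hv.trans hvw.1
  refine FGV_ext (by rw [FGtake_length hv, FGtake_length hw]) fun j hj => ?_
  rw [FGtake_length hw] at hj
  rw [FGentry_take hv hj, FGentry_take hw hj, hvw.2 j (hj.trans_le hv)]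

theorem prefix_FGtake {h a : ℕ} {v w : FGV h} (hv : (v.1 : ℕ) ≤ a) (hw : a ≤ (w.1 : ℕ))
    (hvw : FGprefix v w) : FGprefix v (FGtake a w) := by
  rw [FGprefix_iff] at hvw ⊢
  rw [FGtake_length hw]
  exact ⟨hv, fun j hj => by rw [FGentry_take hw (hj.trans_le hv), hvw.2 j hj]⟩

theorem card_extensions_le {h : ℕ} (v : FGV h) (i : ℕ) :
    #{w : FGV h | FGprefix v w ∧ (w.1 : ℕ) = v.1 + i} ≤ 2 ^ ((h - 1) * i) := by
  have hcard : #(univ : Finset (Fin i → Fin (2 ^ (h - 1)))) = 2 ^ ((h - 1) * i) := by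
    simp [pow_mul]
  rw [← hcard]
  refine card_le_card_of_injOn (fun w j => FGentry w (v.1 + j)) (by simp) ?_
  intro w hw w' hw' heq
  simp only [coe_filter, mem_univ, true_and, Set.mem_ofPred_eq, FGprefix_iff] at hw hw'
  refine FGV_ext (hw.2.trans hw'.2.symm) fun j hj => ?_
  rcases lt_or_ge j v.1 with hjv | hjv
  · rw [hw.1.2 j hjv, hw'.1.2 j hjv]
  · have := congrFun heq ⟨j - v.1, by omega⟩
    simpa [Nat.add_sub_cancel' hjv] using this

/-- The extensions of `r` of length less than `|r| + ℓ`. -/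
def FGcone {h : ℕ} (ℓ : ℕ) (r : FGV h) : Finset (FGV h) :=
  {w | FGprefix r w ∧ (w.1 : ℕ) < r.1 + ℓ}

theorem card_FGcone_le {h : ℕ} (ℓ : ℕ) (r : FGV h) :
    #(FGcone ℓ r) ≤ ∑ i ∈ range ℓ, 2 ^ ((h - 1) * i) := by
  have hmaps : ∀ w ∈ FGcone ℓ r, (w.1 : ℕ) - r.1 ∈ range ℓ := by
    intro w hw
    simp only [FGcone, mem_filter, mem_univ, true_and, FGprefix_iff] at hw
    simp only [mem_range]
    omega
  rw [card_eq_sum_card_fiberwise hmaps]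
  refine sum_le_sum fun i _ => le_trans (card_le_card fun w hw => ?_) (card_extensions_le r i)
  simp only [FGcone, mem_filter, mem_univ, true_and] at hw ⊢
  refine ⟨hw.1.1, ?_⟩
  have := hw.1.1.1
  omega

theorem FGcap_eq {h : ℕ} (v : FGV h) : FGcap v = 2 ^ (h * (h - v.1)) := by
  have := v.1.2
  rw [FGcap, FGlevel, show h - (v.1 + 1) + 1 = h - (v.1 : ℕ) by omega]

theorem card_mul_cap_le {h a : ℕ} (v : FGV h) (hva : (v.1 : ℕ) ≤ a) (hah : a ≤ h) :
    (2 : ℝ) ^ ((h - 1) * (a - v.1)) * 2 ^ (h * (h - a)) ≤ FGcap v := by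
  rw [FGcap_eq, ← pow_add]
  refine pow_le_pow_right₀ one_le_two ?_
  calc (h - 1) * (a - v.1) + h * (h - a) ≤ h * (a - v.1) + h * (h - a) := by
        gcongr
        omega
    _ = h * (h - v.1) := by
        rw [← Nat.mul_add]
        congr 1
        omega

/-- A set lying in the levels `a + 1, …, a + ℓ` is routable as soon as its part below each
level-`(a + 1)` vertex `r` is contained in a set that is routable on the cone of `r`. -/
theorem routable_of_cones {h a ℓ : ℕ} (hℓ : 1 ≤ ℓ) (X : FGV h → Finset (FGV h))
    (hX : ∀ r, SRoutable (X r) (FGcone ℓ r)) :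
    Routable ({w | (a ≤ (w.1 : ℕ) ∧ (w.1 : ℕ) < a + ℓ) ∧ w ∈ X (FGtake a w)} : Finset (FGV h)) := by
  intro v
  unfold RoutableOn
  rcases lt_or_ge (v.1 : ℕ) a with hva | hav
  · set T : Finset (FGV h) := {r | FGprefix v r ∧ (r.1 : ℕ) = v.1 + (a - v.1)} with hT
    have hmaps : ∀ w ∈ ({w | (a ≤ (w.1 : ℕ) ∧ (w.1 : ℕ) < a + ℓ) ∧ w ∈ X (FGtake a w)} :
        Finset (FGV h)).filter (fun w => FGprefix v w), FGtake a w ∈ T := by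
      intro w hw
      simp only [mem_filter, mem_univ, true_and] at hw
      simp only [hT, mem_filter, mem_univ, true_and, FGtake_length hw.1.1.1]
      exact ⟨prefix_FGtake hva.le hw.1.1.1 hw.2, by omega⟩
    rw [← sum_fiberwise_of_maps_to hmaps]
    have hbound : ∀ r ∈ T, ∑ w ∈ (({w | (a ≤ (w.1 : ℕ) ∧ (w.1 : ℕ) < a + ℓ) ∧
        w ∈ X (FGtake a w)} : Finset (FGV h)).filter (fun w => FGprefix v w)).filter
          (fun w => FGtake a w = r), FGdemand w ≤ 2 ^ (h * (h - a)) := by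
      intro r hr
      simp only [hT, mem_filter, mem_univ, true_and] at hr
      have hra : (r.1 : ℕ) = a := by omega
      have hroute := hX r r (by
        simp only [FGcone, mem_filter, mem_univ, true_and, FGprefix_iff]
        exact ⟨⟨le_rfl, fun _ _ => trivial⟩, by omega⟩)
      rw [RoutableOn, FGcap_eq, hra] at hroute
      refine le_trans (sum_le_sum_of_subset_of_nonneg (fun w hw => ?_)
        fun w _ _ => FGdemand_nonneg w) hroute
      simp only [mem_filter, mem_univ, true_and] at hw ⊢
      obtain ⟨⟨⟨⟨haw, -⟩, hwX⟩, -⟩, rfl⟩ := hw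
      exact ⟨hwX, FGtake_prefix haw⟩
    rcases le_or_gt a h with hah | hah
    · calc _ ≤ ∑ r ∈ T, (2 : ℝ) ^ (h * (h - a)) := sum_le_sum hbound
        _ = (#T : ℝ) * 2 ^ (h * (h - a)) := by rw [sum_const, nsmul_eq_mul]
        _ ≤ (2 : ℝ) ^ ((h - 1) * (a - v.1)) * 2 ^ (h * (h - a)) := by
            gcongr
            exact_mod_cast card_extensions_le v (a - v.1)
        _ ≤ FGcap v := card_mul_cap_le v hva.le hah
    · have hTe : T = ∅ := by
        refine filter_eq_empty_iff.2 fun r _ hr => ?_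
        have := r.1.2
        omega
      rw [hTe, sum_empty, FGcap_eq]
      positivity
  · rcases lt_or_ge (v.1 : ℕ) (a + ℓ) with hvl | hlv
    · have hroute := hX (FGtake a v) v (by
        simp only [FGcone, mem_filter, mem_univ, true_and, FGtake_length hav]
        exact ⟨FGtake_prefix hav, hvl⟩)
      refine le_trans (sum_le_sum_of_subset_of_nonneg (fun w hw => ?_)
        fun w _ _ => FGdemand_nonneg w) hroute
      simp only [mem_filter, mem_univ, true_and] at hw ⊢
      exact ⟨FGtake_eq_of_prefix hav hw.2 ▸ hw.1.2, hw.2⟩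
    · rw [filter_eq_empty_iff.2, sum_empty, FGcap_eq]
      · positivity
      · intro w hw hvw
        simp only [mem_filter, mem_univ, true_and] at hw
        have := hvw.1
        omega

theorem FGKI_anti {h : ℕ} {S S' : Finset (FGV h)} (hS : S ⊆ S') : FGKI S' ⊆ FGKI S :=
  convexHull_mono fun _ ⟨X, hX, hx⟩ => ⟨X, fun v hv => hX v (hS hv), hx⟩

theorem mem_FGKI_of_mem_FGP {h t : ℕ} {x : FGV h → ℝ} (hx : x ∈ FGP h t)
    (ht : t ≤ Fintype.card (FGV h)) {S : Finset (FGV h)} (hS : #S ≤ t) : x ∈ FGKI S := by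
  obtain ⟨S', hSS', hS'⟩ := exists_superset_card_eq hS ht
  exact FGKI_anti hSS' (Set.mem_iInter₂.1 hx S' hS')

theorem exists_SRoutable_ge {h : ℕ} {S : Finset (FGV h)} {x : FGV h → ℝ} (hx : x ∈ FGKI S)
    (B : Finset (FGV h)) (c : FGV h → ℝ) :
    ∃ X, SRoutable X S ∧ ∑ w ∈ B, c w * x w ≤ ∑ w ∈ B with w ∈ X, c w := by
  let f : (FGV h → ℝ) →ₗ[ℝ] ℝ := ∑ w ∈ B, c w • LinearMap.proj w
  obtain ⟨_, ⟨X, hX, rfl⟩, hle⟩ :=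
    (f.convexOn convex_univ).exists_ge_of_mem_convexHull (Set.subset_univ _) hx
  refine ⟨X, hX, ?_⟩
  simpa [f, sum_filter] using hle

theorem block_profit_le {h : ℕ}
    (hrout : ∀ X : Finset (FGV h), Routable X → ∑ w ∈ X, FGprofit w ≤ 2)
    {ℓ : ℕ} (hℓ : 1 ≤ ℓ) {x : FGV h → ℝ} (hx : ∀ r, x ∈ FGKI (FGcone ℓ r)) (a : ℕ) :
    ∑ v : FGV h with a ≤ (v.1 : ℕ) ∧ (v.1 : ℕ) < a + ℓ, FGprofit v * x v ≤ 2 := by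
  choose X hX hle using fun r => exists_SRoutable_ge (hx r)
    {v : FGV h | (a ≤ (v.1 : ℕ) ∧ (v.1 : ℕ) < a + ℓ) ∧ FGtake a v = r} FGprofit
  refine le_trans ?_ (hrout _ (routable_of_cones (a := a) hℓ X hX))
  rw [← sum_fiberwise _ (FGtake a) fun v => FGprofit v * x v, ← sum_fiberwise _ (FGtake a) FGprofit]
  refine sum_le_sum fun r _ => ?_
  rw [filter_filter]
  refine (hle r).trans_eq (sum_congr ?_ fun _ _ => rfl)
  ext w
  simp only [mem_filter, mem_univ, true_and]
  constructor
  · rintro ⟨⟨hw, rfl⟩, hwX⟩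
    exact ⟨⟨hw, hwX⟩, rfl⟩
  · rintro ⟨⟨hw, hwX⟩, rfl⟩
    exact ⟨⟨hw, rfl⟩, hwX⟩

theorem fg_upper_bound (h : ℕ) (hh : 2 ≤ h)
    (hrout : ∀ X : Finset (FGV h), Routable X → ∑ w ∈ X, FGprofit w ≤ 2)
    (ℓ t : ℕ) (hℓ : 1 ≤ ℓ)
    (hnℓ : ∑ i ∈ Finset.range ℓ, 2 ^ ((h - 1) * i) ≤ t)
    (ht : t ≤ Fintype.card (FGV h))
    (x : FGV h → ℝ) (hx : x ∈ FGP h t) :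
    ∑ v : FGV h, FGprofit v * x v ≤ 2 * (⌈(h : ℝ) / (ℓ : ℝ)⌉₊ : ℝ) := by
  have hKI : ∀ r, x ∈ FGKI (FGcone ℓ r) := fun r =>
    mem_FGKI_of_mem_FGP hx ht ((card_FGcone_le ℓ r).trans hnℓ)
  have hℓ' : (0 : ℝ) < ℓ := by exact_mod_cast hℓ
  have hm : h ≤ ⌈(h : ℝ) / (ℓ : ℝ)⌉₊ * ℓ := by
    have := (div_le_iff₀ hℓ').1 (Nat.le_ceil ((h : ℝ) / (ℓ : ℝ)))
    exact_mod_cast this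
  have hmaps : ∀ v ∈ (univ : Finset (FGV h)),
      (v.1 : ℕ) / ℓ ∈ range ⌈(h : ℝ) / (ℓ : ℝ)⌉₊ := fun v _ =>
    mem_range.2 ((Nat.div_lt_iff_lt_mul hℓ).2 (v.1.2.trans_le hm))
  rw [← sum_fiberwise_of_maps_to hmaps]
  calc _ ≤ ∑ _j ∈ range ⌈(h : ℝ) / (ℓ : ℝ)⌉₊, (2 : ℝ) := by
        refine sum_le_sum fun j _ => ?_
        refine le_of_eq_of_le (sum_congr (filter_congr fun v _ => ?_) fun _ _ => rfl)
          (block_profit_le hrout hℓ hKI (j * ℓ))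
        rw [Nat.div_eq_iff hℓ]
        omega
    _ = 2 * (⌈(h : ℝ) / (ℓ : ℝ)⌉₊ : ℝ) := by
        rw [sum_const, card_range, nsmul_eq_mul, mul_comm]
end
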